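/- arXiv:math/0309290 — 3 statements merged into one kernel-verified Lean document; each statement's English description precedes it below -/
import Mathlib

section
/- Assume in addition that the bracket on A is alternating ({a,a} = 0 for all a ∈ A) and satisfies the Jacobi identity. Extend it ε-bilinearly to D₁ by {a + εb, c + εd} := {a,c} + ε({a,d} + {b,c}). Then this extended bracket is a Lie bracket on D₁ (k-bilinear, alternating, satisfying Jacobi), and it is a derivation of the star product in each argument: {u, v * w} = {u,v} * w + v * {u,w} for all u, v, w ∈ D₁. -/
/- Context for Statements 6–9: `A` a commutative unital `k`-algebra with a
`k`-bilinear bracket which is a derivation in each argument; `D₁ = A ⊕ Aε` is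
modelled as `A × A` with the star product
`(a + εb) * (c + εd) = ac + ε(ad + bc + {a,c})`. -/

/-- The first-order star product on `D₁ = A ⊕ Aε`. -/
def starMul {A : Type*} [CommRing A] (br : A → A → A) (u v : A × A) : A × A :=
  (u.1 * v.1, u.1 * v.2 + u.2 * v.1 + br u.1 v.1)

/-- The `ε`-bilinear extension of the bracket to `D₁`:
`{a + εb, c + εd} = {a,c} + ε({a,d} + {b,c})`. -/
def extBracket {A : Type*} [CommRing A] (br : A → A → A) (u v : A × A) : A × A :=
  (br u.1 v.1, br u.1 v.2 + br u.2 v.1)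

/- STATEMENT 7.
Assume in addition that the bracket on `A` is alternating and satisfies the
Jacobi identity.  Then the `ε`-bilinearly extended bracket is a Lie bracket on
`D₁` (`k`-bilinear, alternating, satisfying Jacobi), and it is a derivation of
the star product in each argument: `{u, v * w} = {u,v} * w + v * {u,w}`. -/
theorem extBracket_lie_and_derivation_of_star
    {k A : Type*} [CommRing k] [CommRing A] [Algebra k A]
    (br : A → A → A)
    (hadd_l : ∀ a b c : A, br (a + b) c = br a c + br b c)
    (hadd_r : ∀ a b c : A, br a (b + c) = br a b + br a c)
    (hsmul_l : ∀ (r : k) (a b : A), br (r • a) b = r • br a b)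
    (hsmul_r : ∀ (r : k) (a b : A), br a (r • b) = r • br a b)
    (hleib_l : ∀ a b c : A, br (a * b) c = a * br b c + br a c * b)
    (hleib_r : ∀ a b c : A, br a (b * c) = br a b * c + b * br a c)
    (halt : ∀ a : A, br a a = 0)
    (hjac : ∀ a b c : A, br a (br b c) + br b (br c a) + br c (br a b) = 0) :
    -- `k`-bilinearity of the extended bracket
    (∀ u v w : A × A, extBracket br (u + v) w = extBracket br u w + extBracket br v w) ∧
    (∀ u v w : A × A, extBracket br u (v + w) = extBracket br u v + extBracket br u w) ∧
    (∀ (r : k) (u v : A × A), extBracket br (r • u) v = r • extBracket br u v) ∧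
    (∀ (r : k) (u v : A × A), extBracket br u (r • v) = r • extBracket br u v) ∧
    -- alternating
    (∀ u : A × A, extBracket br u u = 0) ∧
    -- Jacobi identity
    (∀ u v w : A × A,
      extBracket br u (extBracket br v w) + extBracket br v (extBracket br w u) +
        extBracket br w (extBracket br u v) = 0) ∧
    -- derivation of the star product in each argument
    (∀ u v w : A × A,
      extBracket br u (starMul br v w) =
        starMul br (extBracket br u v) w + starMul br v (extBracket br u w)) := by
  have hanti (a b : A) : br b a = -br a b := by
    have h := halt (a + b)
    rw [hadd_l, hadd_r, hadd_r, halt, halt] at h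
    linear_combination h
  have hneg (a b : A) : br a (-b) = -br a b := by
    simpa using hsmul_r (-1) a b
  refine ⟨fun u v w => ?_, fun u v w => ?_, fun r u v => ?_, fun r u v => ?_, fun u => ?_,
    fun u v w => ?_, fun u v w => ?_⟩
  · ext <;> simp only [extBracket, Prod.fst_add, Prod.snd_add, hadd_l]
    ring
  · ext <;> simp only [extBracket, Prod.fst_add, Prod.snd_add, hadd_r]
    ring
  · ext <;> simp [extBracket, hsmul_l]
  · ext <;> simp [extBracket, hsmul_r]
  · ext
    · exact halt u.1
    · simp [extBracket, hanti u.1 u.2]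
  · ext
    · exact hjac u.1 v.1 w.1
    · simp only [extBracket, Prod.snd_add, Prod.snd_zero, hadd_r]
      linear_combination hjac u.1 v.1 w.2 + hjac u.1 v.2 w.1 + hjac u.2 v.1 w.1
  · ext
    · simp only [extBracket, starMul, Prod.fst_add, hleib_r]
    · simp only [extBracket, starMul, Prod.snd_add, hadd_r, hleib_r]
      have h := hjac u.1 v.1 w.1
      rw [hanti u.1 w.1, hneg, hanti (br u.1 v.1) w.1] at h
      linear_combination h
end

section
/- Let δ : A → A be a k-linear derivation of A which preserves the bracket: δ({a,b}) = {δ(a), b} + {a, δ(b)} for all a, b ∈ A. Then its ε-linear extension δ′(a + εb) := δ(a) + ε·δ(b) is a derivation of the associative algebra (D₁, *), i.e. δ′(u * v) = δ′(u) * v + u * δ′(v), and it also preserves the ε-bilinearly extended bracket {a + εb, c + εd} := {a,c} + ε({a,d} + {b,c}). Moreover δ ↦ δ′ is an injective homomorphism of Lie algebras (with respect to commutator brackets of derivations). This is the splitting underlying Lemma 3.8 of Bezrukavnikov–Kaledin: the extension 0 → H → (Der D)₁ → (Der D)₀ → 0 of Harish-Chandra pairs splits into a semidirect product. -/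
/-- The `ε`-linear extension `δ′` of a map `δ : A → A` to `D₁ = A ⊕ Aε`:
`δ′(a + εb) = δ(a) + ε·δ(b)`. -/
def extDer {A : Type*} (δ : A → A) (u : A × A) : A × A :=
  (δ u.1, δ u.2)

/- STATEMENT 8.
If `δ : A → A` is a `k`-linear derivation of `A` preserving the bracket, then
its `ε`-linear extension `δ′` is a derivation of the associative algebra
`(D₁, *)` and preserves the `ε`-bilinearly extended bracket.  Moreover `δ ↦ δ′`
is an injective homomorphism of Lie algebras with respect to the commutator
brackets of derivations.  (This is the splitting underlying Lemma 3.8 of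
Bezrukavnikov–Kaledin: `(Der D)₁ ≅ H ⋊ (Der D)₀`.) -/
theorem extDer_derivation_of_star_and_lie_embedding
    {k A : Type*} [CommRing k] [CommRing A] [Algebra k A]
    (br : A → A → A)
    (hadd_l : ∀ a b c : A, br (a + b) c = br a c + br b c)
    (hadd_r : ∀ a b c : A, br a (b + c) = br a b + br a c)
    (hsmul_l : ∀ (r : k) (a b : A), br (r • a) b = r • br a b)
    (hsmul_r : ∀ (r : k) (a b : A), br a (r • b) = r • br a b)
    (hleib_l : ∀ a b c : A, br (a * b) c = a * br b c + br a c * b)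
    (hleib_r : ∀ a b c : A, br a (b * c) = br a b * c + b * br a c)
    (δ : A → A)
    (hδadd : ∀ a b : A, δ (a + b) = δ a + δ b)
    (hδsmul : ∀ (r : k) (a : A), δ (r • a) = r • δ a)
    (hδder : ∀ a b : A, δ (a * b) = δ a * b + a * δ b)
    (hδbr : ∀ a b : A, δ (br a b) = br (δ a) b + br a (δ b)) :
    -- `δ′` is a derivation of the star product
    (∀ u v : A × A,
      extDer δ (starMul br u v) = starMul br (extDer δ u) v + starMul br u (extDer δ v)) ∧
    -- `δ′` preserves the extended bracket
    (∀ u v : A × A,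
      extDer δ (extBracket br u v) =
        extBracket br (extDer δ u) v + extBracket br u (extDer δ v)) ∧
    -- `δ ↦ δ′` is a homomorphism for the commutator bracket of derivations ...
    (∀ (δ₁ δ₂ : A → A) (u : A × A),
      extDer (fun a => δ₁ (δ₂ a) - δ₂ (δ₁ a)) u =
        extDer δ₁ (extDer δ₂ u) - extDer δ₂ (extDer δ₁ u)) ∧
    -- ... and it is injective
    (∀ δ₁ δ₂ : A → A, extDer (A := A) δ₁ = extDer δ₂ → δ₁ = δ₂) := by
  refine ⟨fun u v => ?_, fun u v => ?_, fun _ _ _ => rfl, fun δ₁ δ₂ h => ?_⟩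
  · ext
    · exact hδder u.1 v.1
    · simp only [extDer, starMul, Prod.snd_add, hδadd, hδder, hδbr]
      ring
  · ext
    · exact hδbr u.1 v.1
    · simp only [extDer, extBracket, Prod.snd_add, hδadd, hδbr]
      ring
  · funext a
    exact congrArg Prod.fst (congrFun h (a, 0))
end

section
/- Let 0 → A → E₁ → C → 0 and 0 → C → E₂ → B → 0 be short exact sequences in 𝒜, with extension classes e₁ ∈ Ext¹(C,A) and e₂ ∈ Ext¹(B,C), and let c ∈ Ext²(B,A) be their Yoneda composite (the class of the spliced four-term exact sequence 0 → A → E₁ → E₂ → B → 0). Then c = 0 if and only if there exist an object E of 𝒜 and morphisms a : A → E and b : E → B with b ∘ a = 0, together with an isomorphism Ker(b) ≅ E₁ compatible with the maps from A (the map A → Ker(b) induced by a corresponds to the given map A → E₁) and an isomorphism Coker(a) ≅ E₂ compatible with the maps to B, such that the composite E₁ ≅ Ker(b) → E → Coker(a) ≅ E₂ equals the given map E₁ → C → E₂. (This is the splitting criterion for Ext² classes used in Section 5.1 of Bezrukavnikov–Kaledin to define the groupoid Spl(c).) -/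
open CategoryTheory Limits

universe w v u

namespace CategoryTheory.ShortComplex.ShortExact

open Abelian Pretriangulated _root_.DerivedCategory

variable {C : Type u} [Category.{v} C] [Abelian C]

/-- A short complex is short exact if it becomes part of a distinguished triangle after
applying the embedding in degree `0` of the derived category. -/
lemma of_distTriang_singleFunctor [HasDerivedCategory.{w} C] (S : ShortComplex C)
    (δ : (singleFunctor C 0).obj S.X₃ ⟶ ((singleFunctor C 0).obj S.X₁)⟦(1 : ℤ)⟧)
    (hT : Triangle.mk ((singleFunctor C 0).map S.f) ((singleFunctor C 0).map S.g) δ ∈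
      distTriang (DerivedCategory C)) : S.ShortExact := by
  let H := _root_.DerivedCategory.homologyFunctor C 0
  let e := singleFunctorCompHomologyFunctorIso C 0
  have exact : S.Exact :=
    (exact_iff_of_iso (S.mapNatIso e)).1 (HomologySequence.exact₂ _ hT 0)
  have mono : Mono S.f := by
    have : Mono (H.map ((singleFunctor C 0).map S.f)) :=
      (HomologySequence.mono_homologyMap_mor₁_iff _ hT (-1) 0).2
        ((isZero_of_isGE ((singleFunctor C 0).obj S.X₃) 0 (-1) (by lia)).eq_of_src _ _)
    exact ((MorphismProperty.monomorphisms C).arrow_mk_iso_iff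
      (Arrow.isoOfNatIso e (Arrow.mk S.f))).1 this
  have epi : Epi S.g := by
    have : Epi (H.map ((singleFunctor C 0).map S.g)) :=
      (HomologySequence.epi_homologyMap_mor₂_iff _ hT 0 1).2
        ((isZero_of_isLE ((singleFunctor C 0).obj S.X₁) 0 1 (by lia)).eq_of_tgt _ _)
    exact ((MorphismProperty.epimorphisms C).arrow_mk_iso_iff
      (Arrow.isoOfNatIso e (Arrow.mk S.g))).1 this
  exact { exact := exact }

/-- The connecting morphism of a short exact sequence is determined by the condition that
it completes the sequence to a distinguished triangle. -/
lemma singleδ_eq_of_distTriang [HasDerivedCategory.{w} C] {S : ShortComplex C}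
    (hS : S.ShortExact)
    (δ : (singleFunctor C 0).obj S.X₃ ⟶ ((singleFunctor C 0).obj S.X₁)⟦(1 : ℤ)⟧)
    (hT : Triangle.mk ((singleFunctor C 0).map S.f) ((singleFunctor C 0).map S.g) δ ∈
      distTriang (DerivedCategory C)) : hS.singleδ = δ := by
  let Φ := singleFunctor C 0
  obtain ⟨c, hc₂, hc₃⟩ : ∃ c : Φ.obj S.X₃ ⟶ Φ.obj S.X₃,
      Φ.map S.g ≫ c = 𝟙 (Φ.obj S.X₂) ≫ Φ.map S.g ∧
        hS.singleδ ≫ (𝟙 (Φ.obj S.X₁))⟦(1 : ℤ)⟧' = c ≫ δ :=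
    complete_distinguished_triangle_morphism _ _ hS.singleTriangle_distinguished hT _ _
      ((Category.comp_id _).trans (Category.id_comp _).symm)
  obtain ⟨c, rfl⟩ := Φ.map_surjective c
  have := hS.epi_g
  obtain rfl : c = 𝟙 _ := by
    rw [← cancel_epi S.g]
    apply Φ.map_injective
    simpa using hc₂
  rw [Φ.map_id, Category.id_comp] at hc₃
  exact ((Category.comp_id _).symm.trans
    (congrArg (hS.singleδ ≫ ·) (Functor.map_id _ _).symm)).trans hc₃

/-- Every class in `Ext¹` is the class of a short exact sequence. -/
lemma exists_extClass_eq [HasExt.{w} C] {X A : C} (α : Ext X A 1) :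
    ∃ (E : C) (a : A ⟶ E) (p : E ⟶ X) (w : a ≫ p = 0)
      (h : (ShortComplex.mk a p w).ShortExact), h.extClass = α := by
  let := HasDerivedCategory.standard C
  let δ : (singleFunctor C 0).obj X ⟶ ((singleFunctor C 0).obj A)⟦(1 : ℤ)⟧ := α.hom
  obtain ⟨K, i, q, hT⟩ := distinguished_cocone_triangle₂ δ
  have : K.IsLE 0 := TStructure.t.isLE₂ _ hT 0
    (inferInstanceAs (((singleFunctor C 0).obj A).IsLE 0))
    (inferInstanceAs (((singleFunctor C 0).obj X).IsLE 0))
  have : K.IsGE 0 := TStructure.t.isGE₂ _ hT 0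
    (inferInstanceAs (((singleFunctor C 0).obj A).IsGE 0))
    (inferInstanceAs (((singleFunctor C 0).obj X).IsGE 0))
  obtain ⟨E, ⟨e⟩⟩ := exists_iso_singleFunctor_obj_of_isGE_of_isLE K 0
  obtain ⟨a, ha⟩ := (singleFunctor C 0).map_surjective (i ≫ e.hom)
  obtain ⟨p, hp⟩ := (singleFunctor C 0).map_surjective (e.inv ≫ q)
  have comm₁ : (singleFunctor C 0).map a ≫ e.inv = 𝟙 ((singleFunctor C 0).obj A) ≫ i := by
    simp [ha]
  have comm₂ : (singleFunctor C 0).map p ≫ 𝟙 ((singleFunctor C 0).obj X) = e.inv ≫ q := by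
    simp [hp]
  have comm₃ : δ ≫ (𝟙 ((singleFunctor C 0).obj A))⟦(1 : ℤ)⟧' =
      𝟙 ((singleFunctor C 0).obj X) ≫ δ := by
    rw [Functor.map_id, Category.id_comp, Category.comp_id]
  have hT' : Triangle.mk ((singleFunctor C 0).map a) ((singleFunctor C 0).map p) δ ∈
      distTriang (DerivedCategory C) :=
    isomorphic_distinguished _ hT _
      (Triangle.isoMk _ _ (Iso.refl _) e.symm (Iso.refl _) comm₁ comm₂ comm₃)
  have w : a ≫ p = 0 := by
    apply (singleFunctor C 0).map_injective
    simpa using! comp_distTriang_mor_zero₁₂ _ hT'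
  have h := of_distTriang_singleFunctor (ShortComplex.mk a p w) δ hT'
  refine ⟨E, a, p, w, h, ?_⟩
  ext
  rw [extClass_hom]
  exact h.singleδ_eq_of_distTriang δ hT'

/-- A morphism between the third terms of two short exact sequences with the same first term
lifts to the middle terms if it is compatible with the extension classes. -/
lemma exists_lift_of_extClass_eq [HasExt.{w} C] {A E₁ X₁ E₂ X₂ : C}
    {f₁ : A ⟶ E₁} {g₁ : E₁ ⟶ X₁} {w₁ : f₁ ≫ g₁ = 0}
    {f₂ : A ⟶ E₂} {g₂ : E₂ ⟶ X₂} {w₂ : f₂ ≫ g₂ = 0}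
    (h₁ : (ShortComplex.mk f₁ g₁ w₁).ShortExact) (h₂ : (ShortComplex.mk f₂ g₂ w₂).ShortExact)
    (φ : X₁ ⟶ X₂) (hφ : (Ext.mk₀ φ).comp h₂.extClass (zero_add 1) = h₁.extClass) :
    ∃ ψ : E₁ ⟶ E₂, f₁ ≫ ψ = f₂ ∧ ψ ≫ g₂ = g₁ ≫ φ := by
  obtain ⟨x, hx⟩ := Ext.contravariant_sequence_exact₁ h₁ _ (Ext.mk₀ f₂) (add_zero 1) (by
    rw [← hφ, Ext.comp_assoc_of_third_deg_zero]
    exact (congrArg (fun z ↦ (Ext.mk₀ φ).comp z (zero_add 1)) h₂.extClass_comp).trans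
      (Ext.comp_zero _ _ _ _ _))
  obtain ⟨ψ, rfl⟩ := (Ext.mk₀_bijective _ _).2 x
  have hψ : f₁ ≫ ψ = f₂ := (Ext.mk₀_bijective _ _).1 (by simpa using hx)
  have := h₁.epi_g
  obtain ⟨u, hu⟩ : ∃ u : X₁ ⟶ X₂, g₁ ≫ u = ψ ≫ g₂ :=
    ⟨_, h₁.exact.g_desc (ψ ≫ g₂) (by dsimp; rw [reassoc_of% hψ, w₂])⟩
  let τ : ShortComplex.mk f₁ g₁ w₁ ⟶ ShortComplex.mk f₂ g₂ w₂ :=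
    { τ₁ := 𝟙 A, τ₂ := ψ, τ₃ := u, comm₁₂ := by simp [hψ], comm₂₃ := hu.symm }
  have hτ : (Ext.mk₀ u).comp h₂.extClass (zero_add 1) = h₁.extClass :=
    (extClass_naturality h₁ h₂ τ).symm.trans (Ext.comp_mk₀_id _)
  obtain ⟨x, hx⟩ := Ext.covariant_sequence_exact₃ _ h₂ (Ext.mk₀ (φ - u)) (zero_add 1) (by
    rw [sub_eq_add_neg, Ext.mk₀_add, Ext.mk₀_neg, Ext.add_comp, Ext.neg_comp]
    exact (congrArg₂ (· + -·) hφ hτ).trans (add_neg_cancel _))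
  obtain ⟨t, rfl⟩ := (Ext.mk₀_bijective _ _).2 x
  have ht : t ≫ g₂ = φ - u := (Ext.mk₀_bijective _ _).1 (by simpa using hx)
  exact ⟨ψ + g₁ ≫ t, by simp [hψ, reassoc_of% w₁], by simp [ht, hu]⟩

end CategoryTheory.ShortComplex.ShortExact

/- STATEMENT 14.
Let `𝒜` be an abelian category (with Ext groups).  Let
`0 → A → E₁ → X → 0` and `0 → X → E₂ → B → 0` be short exact sequences with
extension classes `e₁ ∈ Ext¹(X,A)`, `e₂ ∈ Ext¹(B,X)`, and let `c ∈ Ext²(B,A)`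
be their Yoneda composite (the class of the spliced four-term exact sequence
`0 → A → E₁ → E₂ → B → 0`).  Then `c = 0` if and only if there exist an object
`E`, morphisms `a : A → E`, `b : E → B` with `b ∘ a = 0`, an isomorphism
`Ker(b) ≅ E₁` compatible with the maps from `A`, and an isomorphism
`Coker(a) ≅ E₂` compatible with the maps to `B`, such that the composite
`E₁ ≅ Ker(b) → E → Coker(a) ≅ E₂` equals the given map `E₁ → X → E₂`.
(This is the splitting criterion for `Ext²` classes used in Section 5.1 of
Bezrukavnikov–Kaledin to define the groupoid `Spl(c)`.) -/
theorem ext_two_class_zero_iff_splitting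
    {𝒜 : Type u} [Category.{v} 𝒜] [Abelian 𝒜] [HasExt.{w} 𝒜]
    {A E₁ X E₂ B : 𝒜}
    (f : A ⟶ E₁) (g : E₁ ⟶ X) (w₁ : f ≫ g = 0)
    (f' : X ⟶ E₂) (g' : E₂ ⟶ B) (w₂ : f' ≫ g' = 0)
    (h₁ : (ShortComplex.mk f g w₁).ShortExact)
    (h₂ : (ShortComplex.mk f' g' w₂).ShortExact) :
    -- the Yoneda composite `c = e₂ ∘ e₁ ∈ Ext²(B,A)` vanishes ...
    h₂.extClass.comp h₁.extClass rfl = 0 ↔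
      -- ... iff there is a splitting diagram `A → E → B`
      ∃ (E : 𝒜) (a : A ⟶ E) (b : E ⟶ B) (w : a ≫ b = 0)
        (i : E₁ ≅ kernel b) (j : cokernel a ≅ E₂),
        -- the map `A → Ker(b)` induced by `a` corresponds to the given `A → E₁`
        kernel.lift b a w = f ≫ i.hom ∧
        -- the map `Coker(a) → B` induced by `b` corresponds to the given `E₂ → B`
        cokernel.desc a b w = j.hom ≫ g' ∧
        -- the composite `E₁ ≅ Ker(b) → E → Coker(a) ≅ E₂` is the given `E₁ → X → E₂`
        i.hom ≫ kernel.ι b ≫ cokernel.π a ≫ j.hom = g ≫ f' := by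
  constructor
  · intro h
    obtain ⟨α, hα⟩ := Abelian.Ext.contravariant_sequence_exact₁ h₂ _ _ rfl h
    obtain ⟨E, a, p, hap, hE, rfl⟩ := ShortComplex.ShortExact.exists_extClass_eq α
    obtain ⟨ψ, hψ₁, hψ₂⟩ := h₁.exists_lift_of_extClass_eq hE f' hα
    have hf := h₁.mono_f
    have hg := h₁.epi_g
    have hf' := h₂.mono_f
    have ha := hE.mono_f
    dsimp at hf hg hf' ha
    have hψb : ψ ≫ p ≫ g' = 0 := by rw [reassoc_of% hψ₂, w₂, comp_zero]
    have hψ : Mono ψ := Preadditive.mono_of_cancel_zero _ fun x hx ↦ by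
      obtain ⟨l, hl⟩ : ∃ l, l ≫ f = x := ⟨_, h₁.exact.lift_f x (by
        rw [← cancel_mono f', zero_comp, Category.assoc, ← hψ₂, reassoc_of% hx, zero_comp])⟩
      have hl' : l = 0 := by rw [← cancel_mono a, ← hψ₁, reassoc_of% hl, hx, zero_comp]
      rw [← hl, hl', zero_comp]
    have hex : (ShortComplex.mk ψ (p ≫ g') hψb).Exact := by
      rw [ShortComplex.exact_iff_exact_up_to_refinements]
      intro T x hx
      dsimp at x hx
      obtain ⟨l, hl⟩ : ∃ l, l ≫ f' = x ≫ p := ⟨_, h₂.exact.lift_f (x ≫ p) (by simpa using hx)⟩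
      obtain ⟨T', π, hπ, y, hy⟩ := surjective_up_to_refinements_of_epi g l
      obtain ⟨s, hs⟩ : ∃ s, s ≫ a = π ≫ x - y ≫ ψ := ⟨_, hE.exact.lift_f (π ≫ x - y ≫ ψ) (by
        simp [hψ₂, ← hl, reassoc_of% hy])⟩
      exact ⟨T', π, hπ, y + s ≫ f, by simp [hψ₁, hs]⟩
    let i : E₁ ≅ kernel (p ≫ g') := hex.fIsKernel.conePointUniqueUpToIso (limit.isLimit _)
    let j : cokernel a ≅ E₂ := (colimit.isColimit _).coconePointUniqueUpToIso hE.gIsCokernel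
    have hi : i.hom ≫ kernel.ι (p ≫ g') = ψ :=
      hex.fIsKernel.conePointUniqueUpToIso_hom_comp _ WalkingParallelPair.zero
    have hj : cokernel.π a ≫ j.hom = p :=
      (colimit.isColimit _).comp_coconePointUniqueUpToIso_hom _ WalkingParallelPair.one
    refine ⟨E, a, p ≫ g', by rw [reassoc_of% hap, zero_comp], i, j, ?_, ?_, ?_⟩
    · simp [← cancel_mono (kernel.ι (p ≫ g')), hi, hψ₁]
    · simp [← cancel_epi (cokernel.π a), reassoc_of% hj]
    · rw [reassoc_of% hi, hj, hψ₂]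
  · rintro ⟨E, a, b, w, i, j, hi, hj, hij⟩
    have := h₁.mono_f
    have := h₁.epi_g
    dsimp at *
    have ha : Mono a := by
      rw [← kernel.lift_ι b a w, hi]
      infer_instance
    have hS : (ShortComplex.mk a (cokernel.π a) (cokernel.condition a)).ShortExact :=
      { exact := ShortComplex.exact_cokernel a }
    let φ : ShortComplex.mk f g w₁ ⟶ ShortComplex.mk a (cokernel.π a) (cokernel.condition a) :=
      { τ₁ := 𝟙 A
        τ₂ := i.hom ≫ kernel.ι b
        τ₃ := f' ≫ j.inv
        comm₁₂ := by simp [← reassoc_of% hi]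
        comm₂₃ := by simp [← reassoc_of% hij] }
    have key := ShortComplex.ShortExact.extClass_naturality h₁ hS φ
    dsimp [φ] at key
    rw [Abelian.Ext.comp_mk₀_id, ← Abelian.Ext.mk₀_comp_mk₀_assoc] at key
    rw [key]
    exact h₂.extClass_comp_assoc _
end
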